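/- arXiv:2005.10968 — 2 statements merged into one kernel-verified Lean document; each statement's English description precedes it below -/
import Mathlib

section
/- Let E ⊆ ℕA be the exponent set of a monomial ideal. For every b ∈ std(E) there exists a standard pair (a,F) of E with b ∈ a + ℕF; that is, the standard pairs of E cover its standard monomials. -/
open scoped BigOperators

namespace StdPairsPaper

/-- The coercion of a lattice point to a real vector. -/
def toR {d : ℕ} (v : Fin d → ℤ) : Fin d → ℝ := fun i => (v i : ℝ)

/-- The cone of nonnegative real combinations of (the real images of) elements of `S`. -/
def cone {d : ℕ} (S : Set (Fin d → ℤ)) : Set (Fin d → ℝ) :=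
  {x | ∃ (t : Finset (Fin d → ℤ)) (c : (Fin d → ℤ) → ℝ),
    (t : Set (Fin d → ℤ)) ⊆ S ∧ (∀ v, 0 ≤ c v) ∧ x = ∑ v ∈ t, c v • toR v}

/-- `ℕS`, the submonoid of `ℤ^d` generated by `S`. -/
def NSemi {d : ℕ} (S : Set (Fin d → ℤ)) : AddSubmonoid (Fin d → ℤ) :=
  AddSubmonoid.closure S

/-- `ℤS`, the subgroup of `ℤ^d` generated by `S`. -/
def ZGrp {d : ℕ} (S : Set (Fin d → ℤ)) : AddSubgroup (Fin d → ℤ) :=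
  AddSubgroup.closure S

/-- `ℝS`, the real linear span of `S`. -/
def RSpan {d : ℕ} (S : Set (Fin d → ℤ)) : Submodule ℝ (Fin d → ℝ) :=
  Submodule.span ℝ (toR '' S)

/-- `A` is a configuration: a finite set of nonzero lattice points whose `ℤ`-span is `ℤ^d`
and whose nonnegative real cone is strongly convex (contains no line, i.e. is pointed). -/
structure IsConfig {d : ℕ} (A : Set (Fin d → ℤ)) : Prop where
  (finite : A.Finite)
  (nonzero : (0 : Fin d → ℤ) ∉ A)
  (spans : ZGrp A = ⊤)
  (pointed : ∀ x ∈ cone A, -x ∈ cone A → x = 0)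

/-- `F` is a face of the configuration `A`: `F ⊆ A`, the cone over `F` is an extreme
subset (face) of the cone over `A`, and `ℝ_{≥0}F ∩ A = F`. -/
def IsFace {d : ℕ} (A F : Set (Fin d → ℤ)) : Prop :=
  F ⊆ A ∧ IsExtreme ℝ (cone A) (cone F) ∧ cone F ∩ (toR '' A) = toR '' F

/-- The set `a + ℕF`. -/
def cell {d : ℕ} (a : Fin d → ℤ) (F : Set (Fin d → ℤ)) : Set (Fin d → ℤ) :=
  {x | ∃ f ∈ NSemi F, x = a + f}

/-- Two pairs `(a,F)` and `(b,F)` belonging to the same face `F` overlap: `a - b ∈ ℤF`. -/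
def Overlap {d : ℕ} (F : Set (Fin d → ℤ)) (a b : Fin d → ℤ) : Prop :=
  a - b ∈ ZGrp F

/-- The pair `(a,F)` divides the pair `(b,G)`:
there is `c ∈ ℕA` with `a + c + ℕF ⊆ b + ℕG`. -/
def PairDvd {d : ℕ} (A : Set (Fin d → ℤ)) (a : Fin d → ℤ) (F : Set (Fin d → ℤ))
    (b : Fin d → ℤ) (G : Set (Fin d → ℤ)) : Prop :=
  ∃ c ∈ NSemi A, cell (a + c) F ⊆ cell b G

/-- `E` is the exponent set of a monomial ideal of `ℕA`: `E ⊆ ℕA` and `E + ℕA ⊆ E`. -/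
def IsExpSet {d : ℕ} (A E : Set (Fin d → ℤ)) : Prop :=
  E ⊆ (NSemi A : Set (Fin d → ℤ)) ∧ ∀ e ∈ E, ∀ c ∈ NSemi A, e + c ∈ E

/-- The standard monomials of `E`: `ℕA ∖ E`. -/
def stdSet {d : ℕ} (A E : Set (Fin d → ℤ)) : Set (Fin d → ℤ) :=
  (NSemi A : Set (Fin d → ℤ)) \ E

/-- `(a,F)` is a proper pair of `E`: a pair of `A` with `a + ℕF ⊆ std(E)`. -/
def ProperPair {d : ℕ} (A E : Set (Fin d → ℤ)) (a : Fin d → ℤ)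
    (F : Set (Fin d → ℤ)) : Prop :=
  a ∈ NSemi A ∧ IsFace A F ∧ cell a F ⊆ stdSet A E

/-- `(a,F)` is a standard pair of `E`: a proper pair of `E` maximal with respect to
the partial order `(a,F) ≼ (b,G) ↔ a + ℕF ⊆ b + ℕG`. -/
def StdPair {d : ℕ} (A E : Set (Fin d → ℤ)) (a : Fin d → ℤ)
    (F : Set (Fin d → ℤ)) : Prop :=
  ProperPair A E a F ∧
    ∀ b G, ProperPair A E b G → cell a F ⊆ cell b G → cell b G ⊆ cell a F

/-- The overlap class of the standard pair `(a,F)` of `E` is maximal with respect to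
divisibility among overlap classes of standard pairs of `E`. -/
def MaxClass {d : ℕ} (A E : Set (Fin d → ℤ)) (a : Fin d → ℤ)
    (F : Set (Fin d → ℤ)) : Prop :=
  ∀ b G, StdPair A E b G → PairDvd A a F b G → PairDvd A b G a F

noncomputable section

/-- The affine semigroup ring `k[ℕA]`. -/
abbrev SGRing {d : ℕ} (k : Type*) [Field k] (A : Set (Fin d → ℤ)) :=
  AddMonoidAlgebra k (NSemi A)

/-- The monomial `t^a` of `k[ℕA]`. -/
def mono {d : ℕ} (k : Type*) [Field k] (A : Set (Fin d → ℤ)) (a : (NSemi A)) :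
    SGRing k A :=
  AddMonoidAlgebra.single a 1

/-- `I` is a monomial ideal of `k[ℕA]`: an ideal generated by monomials. -/
def IsMonomialIdeal {d : ℕ} (k : Type*) [Field k] (A : Set (Fin d → ℤ))
    (I : Ideal (SGRing k A)) : Prop :=
  ∃ S : Set (NSemi A), I = Ideal.span ((fun a => mono k A a) '' S)

/-- The exponent set `E(I) = {a ∈ ℕA : t^a ∈ I}` of an ideal of `k[ℕA]`,
as a subset of `ℤ^d`. -/
def expSet {d : ℕ} (k : Type*) [Field k] (A : Set (Fin d → ℤ))
    (I : Ideal (SGRing k A)) : Set (Fin d → ℤ) :=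
  {x | ∃ h : x ∈ NSemi A, mono k A ⟨x, h⟩ ∈ I}

/-- The monomial prime ideal `p_F = ⟨t^a : a ∈ ℕA ∖ ℕF⟩` of `k[ℕA]`. -/
def primeF {d : ℕ} (k : Type*) [Field k] (A F : Set (Fin d → ℤ)) :
    Ideal (SGRing k A) :=
  Ideal.span {x | ∃ a : (NSemi A), (a : Fin d → ℤ) ∉ NSemi F ∧ x = mono k A a}

end


theorem zero_mem_cone {d : ℕ} (S : Set (Fin d → ℤ)) : (0 : Fin d → ℝ) ∈ cone S :=
  ⟨∅, 0, by simp, fun _ => le_rfl, by simp⟩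

theorem smul_mem_cone {d : ℕ} {S : Set (Fin d → ℤ)} {x : Fin d → ℝ} (hx : x ∈ cone S)
    {r : ℝ} (hr : 0 ≤ r) : r • x ∈ cone S := by
  obtain ⟨t, c, ht, hc, rfl⟩ := hx
  exact ⟨t, fun v => r * c v, ht, fun v => mul_nonneg hr (hc v), by
    simp [Finset.smul_sum, mul_smul]⟩

theorem cone_empty {d : ℕ} : cone (∅ : Set (Fin d → ℤ)) = {0} := by
  refine Set.Subset.antisymm ?_ (Set.singleton_subset_iff.2 (zero_mem_cone ∅))
  rintro x ⟨t, c, ht, -, rfl⟩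
  have : t = ∅ := by simpa using ht
  simp [this]

theorem toR_eq_zero {d : ℕ} {v : Fin d → ℤ} : toR v = 0 ↔ v = 0 := by
  simp [toR, funext_iff]

theorem toR_sum_nsmul {d : ℕ} {ι : Type*} (s : Finset ι) (u : ι → ℕ) (f : ι → Fin d → ℤ) :
    toR (∑ v ∈ s, u v • f v) = ∑ v ∈ s, (u v : ℝ) • toR (f v) := by
  ext i
  simp [toR, Finset.sum_apply]

theorem isFace_empty {d : ℕ} {A : Set (Fin d → ℤ)} (hA : IsConfig A) : IsFace A ∅ := by
  refine ⟨Set.empty_subset A, ⟨?_, ?_⟩, ?_⟩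
  · rw [cone_empty, Set.singleton_subset_iff]
    exact zero_mem_cone A
  · rw [cone_empty]
    rintro x hx y hy z rfl ⟨p, q, hp, hq, -, h⟩
    refine hA.pointed x hx ?_
    have hxy : -x = (p⁻¹ * q) • y := by
      rw [mul_smul, ← neg_eq_of_add_eq_zero_right h, smul_neg, inv_smul_smul₀ hp.ne']
    rw [hxy]
    exact smul_mem_cone hy (by positivity)
  · rw [cone_empty, Set.image_empty, Set.eq_empty_iff_forall_notMem]
    rintro _ ⟨h, v, hv, rfl⟩
    exact hA.nonzero (toR_eq_zero.1 h ▸ hv)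

theorem mem_NSemi_iff_exists_sum {d : ℕ} {s : Finset (Fin d → ℤ)} {x : Fin d → ℤ} :
    x ∈ NSemi (s : Set (Fin d → ℤ)) ↔ ∃ u : s → ℕ, ∑ v, u v • (v : Fin d → ℤ) = x := by
  constructor
  · intro hx
    induction hx using AddSubmonoid.closure_induction with
    | mem x hx =>
      classical
      exact ⟨Pi.single ⟨x, hx⟩ 1, by simp [Pi.single_apply, ite_smul]⟩
    | zero => exact ⟨0, by simp⟩
    | add x y _ _ hx hy =>
      obtain ⟨u, rfl⟩ := hx
      obtain ⟨w, rfl⟩ := hy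
      exact ⟨u + w, by simp [add_smul, Finset.sum_add_distrib]⟩
  · rintro ⟨u, rfl⟩
    exact sum_mem fun v _ => nsmul_mem (AddSubmonoid.subset_closure v.2) _

theorem eq_zero_of_sum_nsmul_eq_zero {d : ℕ} {s : Finset (Fin d → ℤ)}
    (hs : IsConfig (s : Set (Fin d → ℤ))) {w : s → ℕ}
    (hw : ∑ v, w v • (v : Fin d → ℤ) = 0) : w = 0 := by
  classical
  let c : (Fin d → ℤ) → ℝ := fun v => if h : v ∈ s then (w ⟨v, h⟩ : ℝ) else 0
  have hc : ∀ v, 0 ≤ c v := fun v => by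
    simp only [c]
    split_ifs <;> positivity
  have hsum : ∑ v ∈ s, c v • toR v = 0 := by
    rw [← toR_eq_zero, toR_sum_nsmul] at hw
    rw [← hw, ← Finset.sum_coe_sort]
    simp [c]
  funext ⟨v, hv⟩
  have h0 : c v • toR v = 0 := by
    refine hs.pointed _ ⟨{v}, c, by simpa using hv, hc, by simp⟩
      ⟨s.erase v, c, by simp, hc, ?_⟩
    rw [← Finset.add_sum_erase s _ hv] at hsum
    exact neg_eq_of_add_eq_zero_right hsum
  rcases smul_eq_zero.1 h0 with h | h
  · simpa [c, hv] using h
  · exact absurd (toR_eq_zero.1 h ▸ hv) hs.nonzero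

theorem finite_setOf_sum_nsmul_eq {d : ℕ} {s : Finset (Fin d → ℤ)}
    (hs : IsConfig (s : Set (Fin d → ℤ))) (b : Fin d → ℤ) :
    {u : s → ℕ | ∑ v, u v • (v : Fin d → ℤ) = b}.Finite := by
  refine IsAntichain.finite_of_partiallyWellOrderedOn (r := (· ≤ ·)) ?_
    (Set.isPWO_of_wellQuasiOrderedLE _)
  intro u hu w hw hne hle
  obtain ⟨z, rfl⟩ := exists_add_of_le hle
  have hz : ∑ v, z v • (v : Fin d → ℤ) = 0 := by
    have h := hw.out
    simp only [Pi.add_apply, add_smul, Finset.sum_add_distrib, hu.out] at h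
    exact left_eq_add.1 h.symm
  exact hne (by simp [eq_zero_of_sum_nsmul_eq_zero hs hz])

/-- An element of `ℕA` has only finitely many divisors in `ℕA`. -/
theorem finite_setOf_mem_NSemi_sub_mem_NSemi {d : ℕ} {A : Set (Fin d → ℤ)} (hA : IsConfig A)
    (b : Fin d → ℤ) : {a | a ∈ NSemi A ∧ b - a ∈ NSemi A}.Finite := by
  lift A to Finset (Fin d → ℤ) using hA.finite
  refine (((finite_setOf_sum_nsmul_eq hA b).biUnion fun u _ => Set.finite_Iic u).image
    fun u => ∑ v : A, u v • (v : Fin d → ℤ)).subset ?_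
  rintro a ⟨ha, hba⟩
  obtain ⟨u, rfl⟩ := mem_NSemi_iff_exists_sum.1 ha
  obtain ⟨w, hw⟩ := mem_NSemi_iff_exists_sum.1 hba
  refine ⟨u, Set.mem_biUnion (x := u + w) ?_ (by simp), rfl⟩
  simp only [Set.mem_ofPred_eq, Pi.add_apply, add_smul, Finset.sum_add_distrib, hw]
  exact add_sub_cancel _ b

theorem finite_setOf_properPair_mem_cell {d : ℕ} {A : Set (Fin d → ℤ)} (hA : IsConfig A)
    (E : Set (Fin d → ℤ)) (b : Fin d → ℤ) :
    {p : (Fin d → ℤ) × Set (Fin d → ℤ) | ProperPair A E p.1 p.2 ∧ b ∈ cell p.1 p.2}.Finite := by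
  refine ((finite_setOf_mem_NSemi_sub_mem_NSemi hA b).prod hA.finite.finite_subsets).subset ?_
  rintro ⟨a, F⟩ ⟨⟨ha, hF, -⟩, f, hf, rfl⟩
  exact ⟨⟨ha, by
    rw [add_sub_cancel_left]
    exact AddSubmonoid.closure_mono hF.1 hf⟩, hF.1⟩

theorem cell_empty {d : ℕ} (b : Fin d → ℤ) : cell b ∅ = {b} := by
  ext x
  simp [cell, NSemi]

/-- The standard pairs of a monomial ideal (exponent set `E`) cover
its standard monomials: every `b ∈ std(E)` lies in `a + ℕF` for some standard pair
`(a,F)` of `E`. -/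
theorem stdPairs_cover_stdMonomials {d : ℕ} (A : Set (Fin d → ℤ)) (hA : IsConfig A)
    (E : Set (Fin d → ℤ)) (hE : IsExpSet A E)
    (b : Fin d → ℤ) (hb : b ∈ stdSet A E) :
    ∃ a F, StdPair A E a F ∧ b ∈ cell a F := by
  have hne : {p : (Fin d → ℤ) × Set (Fin d → ℤ) |
      ProperPair A E p.1 p.2 ∧ b ∈ cell p.1 p.2}.Nonempty :=
    ⟨(b, ∅), ⟨hb.1, isFace_empty hA, by simpa [cell_empty] using hb⟩, by simp [cell_empty]⟩
  obtain ⟨⟨a, F⟩, ⟨hp, hbF⟩, hmax⟩ :=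
    (finite_setOf_properPair_mem_cell hA E b).exists_maximalFor (fun p => cell p.1 p.2) _ hne
  exact ⟨a, F, ⟨hp, fun c G hG hle => hmax (j := (c, G)) ⟨hG, hle hbF⟩ hle⟩, hbF⟩

end StdPairsPaper
end

section
/- Let I be a monomial ideal in k[ℕA] all of whose standard pairs belong to the face F. If (a,F) is a standard pair of I whose overlap class is not maximal with respect to divisibility among the overlap classes of standard pairs of I, then for every b ∈ a + ℕF the colon ideal (I : t^b) is not a prime ideal. -/
open scoped BigOperators

namespace StdPairsPaper

section Rationalization

/-- Finitely many positive reals are all positive under a suitable `ℚ`-linear map `ℝ → ℚ`. -/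
theorem exists_linearMap_rat_pos (S : Finset ℝ) (hS : ∀ s ∈ S, 0 < s) :
    ∃ φ : ℝ →ₗ[ℚ] ℚ, ∀ s ∈ S, 0 < φ s := by
  let B := Module.Basis.ofVectorSpace ℚ ℝ
  let ev : ℝ → (Module.Basis.ofVectorSpaceIndex ℚ ℝ → ℝ) → ℝ := fun s r =>
    ∑ i ∈ (B.repr s).support, (B.repr s i : ℝ) * r i
  have hcont : ∀ s, Continuous (ev s) := fun s => by fun_prop
  let U : Set (Module.Basis.ofVectorSpaceIndex ℚ ℝ → ℝ) := ⋂ s ∈ S, ev s ⁻¹' Set.Ioi 0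
  have hU : IsOpen U :=
    isOpen_biInter_finset fun s _ => isOpen_Ioi.preimage (hcont s)
  have hBU : (fun i => B i) ∈ U := by
    simp only [U, Set.mem_iInter, Set.mem_preimage, Set.mem_Ioi]
    intro s hs
    have h : ev s (fun i => B i) = s := by
      conv_rhs => rw [← B.linearCombination_repr s]
      simp [ev, Finsupp.linearCombination_apply, Finsupp.sum, Rat.smul_def]
    rw [h]
    exact hS s hs
  have hdense : DenseRange
      (Pi.map fun (_ : Module.Basis.ofVectorSpaceIndex ℚ ℝ) (q : ℚ) => (q : ℝ)) :=
    DenseRange.piMap fun _ => Rat.denseRange_cast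
  obtain ⟨r, hr⟩ := hdense.exists_mem_open hU ⟨_, hBU⟩
  refine ⟨B.constr ℚ r, fun s hs => ?_⟩
  simp only [U, Set.mem_iInter, Set.mem_preimage, Set.mem_Ioi] at hr
  have h := hr s hs
  have h2 : ev s (Pi.map (fun _ (q : ℚ) => (q : ℝ)) r) = ((B.constr ℚ r s : ℚ) : ℝ) := by
    simp [ev, Module.Basis.constr_apply, Finsupp.sum]
  rw [h2] at h
  exact_mod_cast h

/-- Finitely many nonnegative rationals have a common denominator. -/
theorem exists_nat_mul_eq_natCast {ι : Type*} (T : Finset ι) (q : ι → ℚ) (hq : ∀ i, 0 ≤ q i) :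
    ∃ D : ℕ, 0 < D ∧ ∃ n : ι → ℕ, ∀ i ∈ T, (n i : ℚ) = D * q i := by
  refine ⟨∏ i ∈ T, (q i).den, Finset.prod_pos fun i _ => (q i).den_pos,
    fun i => (∏ j ∈ T, (q j).den) / (q i).den * (q i).num.toNat, fun i hi => ?_⟩
  obtain ⟨m, hm⟩ := Finset.dvd_prod_of_mem (fun j => (q j).den) hi
  have hnum : (((q i).num.toNat : ℤ) : ℚ) = (q i).num := by
    rw [Int.toNat_of_nonneg (Rat.num_nonneg.2 (hq i))]
  simp only [hm]
  rw [Nat.mul_div_cancel_left _ (q i).den_pos]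
  push_cast
  rw [Int.cast_natCast] at hnum
  rw [hnum]
  have := Rat.mul_den_eq_num (q i)
  linear_combination -(m : ℚ) * this

/-- A relation between two nonnegative real combinations of lattice points can be replaced by
one with natural coefficients and the same supports. -/
theorem exists_nat_relation {d : ℕ} (T : Finset (Fin d → ℤ)) (c e : (Fin d → ℤ) → ℝ)
    (hc : ∀ v, 0 ≤ c v) (he : ∀ v, 0 ≤ e v)
    (h : ∑ v ∈ T, c v • toR v = ∑ v ∈ T, e v • toR v) :
    ∃ m n : (Fin d → ℤ) → ℕ, (∀ v ∈ T, m v = 0 ↔ c v = 0) ∧ (∀ v ∈ T, n v = 0 ↔ e v = 0) ∧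
      ∑ v ∈ T, m v • v = ∑ v ∈ T, n v • v := by
  classical
  obtain ⟨φ, hφ⟩ := exists_linearMap_rat_pos ((T.image c ∪ T.image e).filter (0 < ·))
    (by simp)
  have hcpos : ∀ v ∈ T, 0 < c v → 0 < φ (c v) := fun v hv h =>
    hφ _ (Finset.mem_filter.2 ⟨Finset.mem_union_left _ (Finset.mem_image_of_mem _ hv), h⟩)
  have hepos : ∀ v ∈ T, 0 < e v → 0 < φ (e v) := fun v hv h =>
    hφ _ (Finset.mem_filter.2 ⟨Finset.mem_union_right _ (Finset.mem_image_of_mem _ hv), h⟩)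
  let q : (Fin d → ℤ) ⊕ (Fin d → ℤ) → ℚ := Sum.elim (fun v => |φ (c v)|) (fun v => |φ (e v)|)
  obtain ⟨D, hD, n, hn⟩ := exists_nat_mul_eq_natCast (T.disjSum T) q (by simp [q])
  have hDQ : (D : ℚ) ≠ 0 := by exact_mod_cast hD.ne'
  have habs : ∀ g : (Fin d → ℤ) → ℝ, (∀ v, 0 ≤ g v) → (∀ v ∈ T, 0 < g v → 0 < φ (g v)) →
      ∀ v ∈ T, |φ (g v)| = φ (g v) ∧ (φ (g v) = 0 ↔ g v = 0) := by
    intro g hg hpos v hv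
    rcases (hg v).eq_or_lt with h0 | h0
    · simp [← h0]
    · have := hpos v hv h0
      exact ⟨abs_of_pos this, by simp [this.ne', h0.ne']⟩
  have hm : ∀ v ∈ T, (n (.inl v) : ℚ) = D * φ (c v) := fun v hv => by
    rw [hn _ (by simpa using hv)]; simp [q, (habs c hc hcpos v hv).1]
  have hn' : ∀ v ∈ T, (n (.inr v) : ℚ) = D * φ (e v) := fun v hv => by
    rw [hn _ (by simpa using hv)]; simp [q, (habs e he hepos v hv).1]
  refine ⟨fun v => n (.inl v), fun v => n (.inr v), fun v hv => ?_, fun v hv => ?_, ?_⟩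
  · rw [← (habs c hc hcpos v hv).2, ← Nat.cast_eq_zero (R := ℚ), hm v hv]
    simp [hDQ]
  · rw [← (habs e he hepos v hv).2, ← Nat.cast_eq_zero (R := ℚ), hn' v hv]
    simp [hDQ]
  · funext i
    have hφsum : ∀ g : (Fin d → ℤ) → ℝ,
        φ ((∑ v ∈ T, g v • toR v) i) = ∑ v ∈ T, φ (g v) * (v i : ℚ) := by
      intro g
      rw [Finset.sum_apply, map_sum]
      refine Finset.sum_congr rfl fun v _ => ?_
      have : (g v • toR v) i = (v i : ℚ) • g v := by
        simp [toR, Rat.smul_def, mul_comm]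
      rw [this, map_smul, smul_eq_mul, mul_comm]
    have hi := congrArg (fun x => (D : ℚ) * φ (x i)) h
    simp only [hφsum, Finset.mul_sum, ← mul_assoc] at hi
    have : ((∑ v ∈ T, (n (.inl v) : ℤ) * v i : ℤ) : ℚ) =
        (∑ v ∈ T, (n (.inr v) : ℤ) * v i : ℤ) := by
      push_cast
      rw [Finset.sum_congr rfl fun v hv => by rw [hm v hv], hi]
      exact Finset.sum_congr rfl fun v hv => by rw [hn' v hv]
    simpa using! (by exact_mod_cast this :
      (∑ v ∈ T, (n (.inl v) : ℤ) * v i : ℤ) = (∑ v ∈ T, (n (.inr v) : ℤ) * v i : ℤ))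

end Rationalization

section Cone

variable {d : ℕ} {A F : Set (Fin d → ℤ)}

theorem toR_injective : Function.Injective (toR : (Fin d → ℤ) → Fin d → ℝ) := fun v w h => by
  funext i
  exact Int.cast_injective (α := ℝ) (congrFun h i)

theorem toR_add (v w : Fin d → ℤ) : toR (v + w) = toR v + toR w := by
  funext i; simp [toR]

theorem toR_neg (v : Fin d → ℤ) : toR (-v) = -toR v := by
  funext i; simp [toR]

theorem toR_zero : toR (0 : Fin d → ℤ) = 0 := by
  funext i; simp [toR]

/-- Over a subset of a fixed finite set, members of the cone can be written as sums over
that finite set. -/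
theorem mem_cone_iff {T : Finset (Fin d → ℤ)} (hF : F ⊆ T) {x : Fin d → ℝ} :
    x ∈ cone F ↔ ∃ c : (Fin d → ℤ) → ℝ, (∀ v, 0 ≤ c v) ∧ (∀ v, c v ≠ 0 → v ∈ F) ∧
      x = ∑ v ∈ T, c v • toR v := by
  classical
  constructor
  · rintro ⟨t, c, ht, hc, rfl⟩
    refine ⟨fun v => if v ∈ t then c v else 0, fun v => ?_, fun v hv => ?_, ?_⟩
    · dsimp only; split_ifs; exacts [hc v, le_rfl]
    · by_contra h
      exact hv (if_neg fun hvt => h (ht hvt))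
    · have htT : t ⊆ T := fun v hv => hF (ht hv)
      simp only [ite_smul, zero_smul, Finset.sum_ite_mem, Finset.inter_eq_right.2 htT]
  · rintro ⟨c, hc, hcF, rfl⟩
    refine ⟨T.filter (c · ≠ 0), c, fun v hv => hcF v (Finset.mem_filter.1 hv).2, hc, ?_⟩
    rw [Finset.sum_filter_of_ne]
    intro v _ hv hc0
    simp [hc0] at hv

theorem cone_mono (h : F ⊆ A) : cone F ⊆ cone A := by
  rintro x ⟨t, c, ht, hc, rfl⟩
  exact ⟨t, c, ht.trans h, hc, rfl⟩

theorem cone_add_mem (hF : F.Finite) {x y : Fin d → ℝ} (hx : x ∈ cone F) (hy : y ∈ cone F) :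
    x + y ∈ cone F := by
  have hT : F ⊆ (hF.toFinset : Set _) := by simp
  rw [mem_cone_iff hT] at *
  obtain ⟨c, hc, hcF, rfl⟩ := hx
  obtain ⟨e, he, heF, rfl⟩ := hy
  refine ⟨c + e, fun v => add_nonneg (hc v) (he v), fun v hv => ?_, ?_⟩
  · by_contra h
    have h1 : c v = 0 := by_contra fun h' => h (hcF v h')
    have h2 : e v = 0 := by_contra fun h' => h (heF v h')
    simp [h1, h2] at hv
  · simp [add_smul, Finset.sum_add_distrib]

theorem cone_smul_mem {r : ℝ} (hr : 0 ≤ r) {x : Fin d → ℝ} (hx : x ∈ cone F) :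
    r • x ∈ cone F := by
  obtain ⟨t, c, ht, hc, rfl⟩ := hx
  exact ⟨t, fun v => r * c v, ht, fun v => mul_nonneg hr (hc v), by
    simp [Finset.smul_sum, mul_smul]⟩

theorem toR_mem_cone {v : Fin d → ℤ} (hv : v ∈ F) : toR v ∈ cone F :=
  ⟨{v}, fun _ => 1, by simpa using hv, fun _ => zero_le_one, by simp⟩

theorem toR_mem_cone_of_mem_NSemi (hF : F.Finite) {v : Fin d → ℤ} (hv : v ∈ NSemi F) :
    toR v ∈ cone F := by
  induction hv using AddSubmonoid.closure_induction with
  | mem x hx => exact toR_mem_cone hx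
  | zero => exact ⟨∅, 0, by simp, by simp, by simp [toR_zero]⟩
  | add x y _ _ hx hy => rw [toR_add]; exact cone_add_mem hF hx hy

theorem NSemi_mono (h : F ⊆ A) : NSemi F ≤ NSemi A := AddSubmonoid.closure_mono h

theorem IsFace.left_mem_cone (hF : IsFace A F) {x y : Fin d → ℝ} (hx : x ∈ cone A)
    (hy : y ∈ cone A) (hxy : x + y ∈ cone F) : x ∈ cone F := by
  have h := hF.2.1.2 (cone_smul_mem zero_le_two hx) (cone_smul_mem zero_le_two hy) hxy
    ⟨2⁻¹, 2⁻¹, by norm_num, by norm_num, by norm_num, by simp [smul_smul]⟩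
  simpa [smul_smul] using cone_smul_mem (r := 2⁻¹) (by norm_num) h

theorem IsFace.mem_of_toR_mem_cone (hF : IsFace A F) {v : Fin d → ℤ} (hv : v ∈ A)
    (h : toR v ∈ cone F) : v ∈ F := by
  have : toR v ∈ toR '' F := hF.2.2 ▸ ⟨h, v, hv, rfl⟩
  exact toR_injective.mem_set_image.1 this

/-- A subset of `A` cut out by a multiplicatively closed and saturated predicate on `ℕA`
is a face. -/
theorem isFace_sep (hA : A.Finite) (N : (Fin d → ℤ) → Prop) (h0 : N 0)
    (hN : ∀ u ∈ NSemi A, ∀ v ∈ NSemi A, N (u + v) ↔ N u ∧ N v) :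
    IsFace A {a ∈ A | N a} := by
  classical
  set T := hA.toFinset
  set G := {a ∈ A | N a}
  have hAT : A ⊆ T := by simp [T]
  have hTA : ∀ v ∈ T, v ∈ A := by simp [T]
  have hGA : G ⊆ A := Set.sep_subset _ _
  have hsmul : ∀ (m : ℕ) (v), v ∈ A → (N (m • v) ↔ (m ≠ 0 → N v)) := by
    intro m v hv
    have hv' : v ∈ NSemi A := AddSubmonoid.subset_closure hv
    induction m with
    | zero => simp [h0]
    | succ m ih =>
      rw [succ_nsmul, hN _ (nsmul_mem hv' m) _ hv']
      exact ⟨fun h _ => h.2, fun h => ⟨ih.2 fun _ => h m.succ_ne_zero, h m.succ_ne_zero⟩⟩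
  have hsum : ∀ (m : (Fin d → ℤ) → ℕ) (S : Finset (Fin d → ℤ)), S ⊆ T →
      (N (∑ v ∈ S, m v • v) ↔ ∀ v ∈ S, m v ≠ 0 → N v) := by
    intro m S
    induction S using Finset.induction_on with
    | empty => simp [h0]
    | insert v S hv ih =>
      intro hS
      rw [Finset.insert_subset_iff] at hS
      rw [Finset.sum_insert hv, hN _ (nsmul_mem (AddSubmonoid.subset_closure (hTA v hS.1)) _) _
        (sum_mem fun w hw => nsmul_mem (AddSubmonoid.subset_closure (hTA w (hS.2 hw))) _),
        ih hS.2, hsmul _ _ (hTA v hS.1), Finset.forall_mem_insert]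
  have key : ∀ c e : (Fin d → ℤ) → ℝ, (∀ v, 0 ≤ c v) → (∀ v, 0 ≤ e v) →
      (∀ v, c v ≠ 0 → v ∈ G) → ∑ v ∈ T, c v • toR v = ∑ v ∈ T, e v • toR v →
      ∀ v ∈ T, e v ≠ 0 → v ∈ G := by
    intro c e hc he hcG h v hv hev
    obtain ⟨m, n, hm, hn, hmn⟩ := exists_nat_relation T c e hc he h
    have h1 : N (∑ v ∈ T, m v • v) :=
      (hsum m T subset_rfl).2 fun w hw hmw => (hcG w fun h' => hmw ((hm w hw).2 h')).2
    rw [hmn, hsum n T subset_rfl] at h1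
    exact ⟨hTA v hv, h1 v hv fun h' => hev ((hn v hv).1 h')⟩
  refine ⟨hGA, ⟨cone_mono hGA, ?_⟩, ?_⟩
  · rintro x hx y hy z hz ⟨r, s, hr, hs, -, rfl⟩
    rw [mem_cone_iff hAT] at hx hy
    obtain ⟨e, he, heA, rfl⟩ := hx
    obtain ⟨e', he', -, rfl⟩ := hy
    obtain ⟨c, hc, hcG, hce⟩ := (mem_cone_iff (hGA.trans hAT)).1 hz
    refine (mem_cone_iff (hGA.trans hAT)).2 ⟨e, he, fun v hv => ?_, rfl⟩
    refine key c (fun v => r * e v + s * e' v) hc (fun v => by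
      have := he v; have := he' v; positivity) hcG ?_ v (hAT (heA v hv)) ?_
    · rw [← hce]
      simp [add_smul, mul_smul, Finset.sum_add_distrib, Finset.smul_sum]
    · have h1 : 0 < r * e v := mul_pos hr ((he v).lt_of_ne' hv)
      have h2 : 0 ≤ s * e' v := mul_nonneg hs.le (he' v)
      positivity
  · ext x
    constructor
    · rintro ⟨hx, a, ha, rfl⟩
      obtain ⟨c, hc, hcG, hce⟩ := (mem_cone_iff (hGA.trans hAT)).1 hx
      refine ⟨a, key c (Pi.single a 1) hc (fun v => ?_) hcG ?_ a (hAT ha) (by simp), rfl⟩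
      · by_cases h : v = a
        · subst h; simp
        · simp [h]
      · rw [← hce, Finset.sum_eq_single_of_mem a (hAT ha)]
        · simp
        · intro v _ hv
          simp [hv]
    · rintro ⟨a, ha, rfl⟩
      exact ⟨toR_mem_cone ha, a, hGA ha, rfl⟩

end Cone

section StandardPairs

variable {d : ℕ} {A E : Set (Fin d → ℤ)}

theorem wellFoundedOn_NSemi (hA : A.Finite) :
    (NSemi A : Set (Fin d → ℤ)).WellFoundedOn
      fun x y => y - x ∈ NSemi A ∧ x - y ∉ NSemi A := by
  let r : (Fin d → ℤ) → (Fin d → ℤ) → Prop := fun x y => y - x ∈ NSemi A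
  have : IsPreorder (Fin d → ℤ) r :=
    { refl := fun x => by simp [r]
      trans := fun x y z hxy hyz => by simpa [r] using add_mem hyz hxy }
  refine Set.PartiallyWellOrderedOn.wellFoundedOn (r := r) ?_
  have hT : NSemi A = AddSubmonoid.closure (hA.toFinset : Set (Fin d → ℤ)) := by simp [NSemi]
  intro f
  have hf : ∀ n, ∃ a : hA.toFinset → ℕ, (f n : Fin d → ℤ) = ∑ i, a i • i.1 := fun n =>
    AddSubmonoid.mem_closure_finset'.1 (hT ▸ (f n).2)
  choose g hg using hf
  obtain ⟨m, n, hmn, hle⟩ := wellQuasiOrdered_le g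
  refine ⟨m, n, hmn, ?_⟩
  change (f n : Fin d → ℤ) - f m ∈ NSemi A
  have : (f n : Fin d → ℤ) - f m = ∑ i, (g n i - g m i) • i.1 := by
    rw [hg, hg, ← Finset.sum_sub_distrib]
    refine Finset.sum_congr rfl fun i _ => ?_
    rw [sub_eq_iff_eq_add, ← add_smul, Nat.sub_add_cancel (hle i)]
  rw [this]
  exact sum_mem fun i _ => nsmul_mem (AddSubmonoid.subset_closure (hA.mem_toFinset.1 i.2)) _

theorem IsConfig.eq_zero_of_neg_mem (hA : IsConfig A) {v : Fin d → ℤ} (hv : v ∈ NSemi A)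
    (hv' : -v ∈ NSemi A) : v = 0 := by
  refine toR_injective ?_
  rw [toR_zero]
  refine hA.pointed _ (toR_mem_cone_of_mem_NSemi hA.finite hv) ?_
  rw [← toR_neg]
  exact toR_mem_cone_of_mem_NSemi hA.finite hv'

theorem self_mem_cell (a : Fin d → ℤ) (F : Set (Fin d → ℤ)) : a ∈ cell a F :=
  ⟨0, zero_mem _, (add_zero a).symm⟩

/-- Every proper pair lies below a standard pair. -/
theorem ProperPair.exists_stdPair (hA : IsConfig A) {b : Fin d → ℤ} {G : Set (Fin d → ℤ)}
    (h : ProperPair A E b G) : ∃ b' G', StdPair A E b' G' ∧ cell b G ⊆ cell b' G' := by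
  let S : Set (Fin d → ℤ) := {x | ∃ H, ProperPair A E x H ∧ cell b G ⊆ cell x H}
  have hSA : S ⊆ NSemi A := fun x ⟨_, hH, _⟩ => hH.1
  obtain ⟨⟨x, hxS⟩, -, hmin⟩ := ((wellFoundedOn_NSemi hA.finite).subset hSA).has_min
    Set.univ ⟨⟨b, G, h, subset_rfl⟩, trivial⟩
  let K : Set (Set (Fin d → ℤ)) := {H | ProperPair A E x H ∧ cell b G ⊆ cell x H}
  have hK : K.Finite := hA.finite.finite_subsets.subset fun H hH => hH.1.2.1.1
  obtain ⟨H, hH, hmax⟩ := hK.exists_maximal hxS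
  refine ⟨x, H, ⟨hH.1, fun y H' hy hsub => ?_⟩, hH.2⟩
  obtain ⟨f, hf, hxf⟩ := hsub (self_mem_cell x H)
  have hfA : f ∈ NSemi A := NSemi_mono hy.2.1.1 hf
  have hyS : y ∈ S := ⟨H', hy, hH.2.trans hsub⟩
  have hnot := hmin ⟨y, hyS⟩ trivial
  have hxy : x - y = f := by rw [hxf]; abel
  have hyx : y - x ∈ NSemi A := by
    by_contra hcon
    exact hnot ⟨by simpa [hxy] using hfA, hcon⟩
  have hf0 : f = 0 := hA.eq_zero_of_neg_mem hfA (by rw [← hxy, neg_sub]; exact hyx)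
  obtain rfl : x = y := by rw [hxf, hf0, add_zero]
  have hHH' : H ⊆ H' := by
    intro v hv
    obtain ⟨u, hu, hvu⟩ := hsub ⟨v, AddSubmonoid.subset_closure hv, rfl⟩
    obtain rfl := add_left_cancel hvu
    exact hy.2.1.mem_of_toR_mem_cone (hH.1.2.1.1 hv)
      (toR_mem_cone_of_mem_NSemi (hA.finite.subset hy.2.1.1) hu)
  have hH'H : H' ⊆ H := hmax ⟨hy, hH.2.trans hsub⟩ hHH'
  rintro z ⟨u, hu, rfl⟩
  exact ⟨u, NSemi_mono hH'H hu, rfl⟩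

end StandardPairs

section Colon

variable {d : ℕ} {k : Type*} [Field k] {A : Set (Fin d → ℤ)}

theorem mono_mul_mono (u v : NSemi A) : mono k A u * mono k A v = mono k A (u + v) := by
  simp [mono, AddMonoidAlgebra.single_mul_single]

theorem mono_mem_colon_iff (I : Ideal (SGRing k A)) (u b : NSemi A) :
    mono k A u ∈ Submodule.colon I (Ideal.span {mono k A b}) ↔
      (b + u : Fin d → ℤ) ∈ expSet k A I := by
  rw [Ideal.mem_colon_span_singleton, mono_mul_mono, add_comm u b]
  exact ⟨fun h => ⟨(b + u).2, h⟩, fun h => h.2⟩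

end Colon

/-- If all standard pairs of the monomial ideal `I` belong to `F` and
`(a,F)` is a standard pair whose overlap class is *not* maximal with respect to
divisibility, then for every `b ∈ a + ℕF` the colon ideal `(I : t^b)` is not prime. -/
theorem colon_not_prime_of_not_maximal_class {d : ℕ} (k : Type*) [Field k]
    (A : Set (Fin d → ℤ)) (hA : IsConfig A)
    (F : Set (Fin d → ℤ)) (hF : IsFace A F)
    (I : Ideal (SGRing k A)) (hI : IsMonomialIdeal k A I)
    (hall : ∀ a' G, StdPair A (expSet k A I) a' G → G = F)
    (a : Fin d → ℤ) (hstd : StdPair A (expSet k A I) a F)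
    (hnmax : ¬ MaxClass A (expSet k A I) a F)
    (b : Fin d → ℤ) (hb : b ∈ cell a F) (hbA : b ∈ NSemi A) :
    ¬ (Submodule.colon I (Ideal.span {mono k A ⟨b, hbA⟩})).IsPrime := by
  intro hP
  set E := expSet k A I with hE
  let N : (Fin d → ℤ) → Prop := fun u => b + u ∉ E
  have hmem : ∀ u (hu : u ∈ NSemi A), mono k A ⟨u, hu⟩ ∈
      Submodule.colon I (Ideal.span {mono k A ⟨b, hbA⟩}) ↔ ¬ N u := fun u hu => by
    rw [mono_mem_colon_iff]; simp [N, hE]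
  have hN : ∀ u ∈ NSemi A, ∀ v ∈ NSemi A, N (u + v) ↔ N u ∧ N v := by
    intro u hu v hv
    rw [← not_iff_not, ← hmem _ (add_mem hu hv), not_and_or, ← hmem u hu, ← hmem v hv]
    rw [← hP.mul_mem_iff_mem_or_mem, mono_mul_mono]
    rfl
  obtain ⟨f₀, hf₀, hbf₀⟩ := hb
  have h0 : N 0 := by
    simpa [N] using (hstd.1.2.2 ⟨f₀, hf₀, hbf₀⟩).2
  let G : Set (Fin d → ℤ) := {g ∈ A | N g}
  have hGface : IsFace A G := isFace_sep hA.finite N h0 hN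
  have hGN : ∀ u ∈ NSemi G, N u := by
    intro u hu
    induction hu using AddSubmonoid.closure_induction with
    | mem x hx => exact hx.2
    | zero => exact h0
    | add x y hx hy ihx ihy =>
      exact (hN x (NSemi_mono hGface.1 hx) y (NSemi_mono hGface.1 hy)).2 ⟨ihx, ihy⟩
  have hproper : ProperPair A E b G := by
    refine ⟨hbA, hGface, ?_⟩
    rintro x ⟨u, hu, rfl⟩
    exact ⟨add_mem hbA (NSemi_mono hGface.1 hu), hGN u hu⟩
  obtain ⟨b', G', hstd', hsub⟩ := hproper.exists_stdPair hA
  obtain rfl := hall b' G' hstd'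
  have hfin := hA.finite.subset hF.1
  have hGF : G ⊆ G' := by
    intro g hg
    obtain ⟨f₁, hf₁, h₁⟩ := hsub (self_mem_cell b G)
    obtain ⟨f₂, hf₂, h₂⟩ := hsub ⟨g, AddSubmonoid.subset_closure hg, rfl⟩
    have hgf : g + f₁ = f₂ := by
      rw [h₁, add_assoc, add_comm f₁] at h₂
      exact add_left_cancel h₂
    refine hF.mem_of_toR_mem_cone hg.1 (hF.left_mem_cone (toR_mem_cone hg.1)
      (cone_mono hF.1 (toR_mem_cone_of_mem_NSemi hfin hf₁)) ?_)
    rw [← toR_add, hgf]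
    exact toR_mem_cone_of_mem_NSemi hfin hf₂
  have hNF : ∀ c ∈ NSemi A, N c → c ∈ NSemi G' := by
    intro c hc
    induction hc using AddSubmonoid.closure_induction with
    | mem x hx => exact fun h => AddSubmonoid.subset_closure (hGF ⟨hx, h⟩)
    | zero => exact fun _ => zero_mem _
    | add x y hx hy ihx ihy =>
      intro h
      have h' := (hN x hx y hy).1 h
      exact add_mem (ihx h'.1) (ihy h'.2)
  simp only [MaxClass, not_forall] at hnmax
  obtain ⟨b₂, G₂, hstd₂, ⟨c, hc, hcell⟩, hnot⟩ := hnmax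
  obtain rfl := hall b₂ G₂ hstd₂
  have hcN : N c := by
    have h := (hstd₂.1.2.2 (hcell ⟨f₀, hf₀, rfl⟩)).2
    rwa [show a + c + f₀ = b + c by rw [hbf₀]; abel] at h
  have hcF := hNF c hc hcN
  obtain ⟨f', hf', hacf⟩ := hcell (self_mem_cell (a + c) G₂)
  refine hnot ⟨f', NSemi_mono hF.1 hf', ?_⟩
  rw [← hacf]
  rintro x ⟨u, hu, rfl⟩
  exact ⟨c + u, add_mem hcF hu, add_assoc a c u⟩

end StdPairsPaper
end
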